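/- arXiv:1206.0799 — 7 statements merged into one kernel-verified Lean document; each statement's English description precedes it below -/
import Mathlib

section
/- Let G be a finite abelian group (written additively) of order n, and let S ⊆ G be a symmetric subset (i.e. -s ∈ S for every s ∈ S) with 0 ∉ S. The Cayley graph D(G,S) is integral (every eigenvalue of its adjacency matrix over ℂ is an integer) if and only if S is stable under the Galois action, i.e. for every integer k coprime to n and every s ∈ S one has k • s ∈ S. -/
open Polynomial in
/-- An integer polynomial that takes a single value `c` on the primitive `n`-th roots of unity
takes an integer value there. -/
theorem exists_int_eq_of_aeval_primitiveRoots_eq {n : ℕ} (hn : 0 < n) (P : ℤ[X]) (c : ℂ)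
    (h : ∀ ξ ∈ primitiveRoots n ℂ, aeval ξ P = c) : ∃ m : ℤ, c = (m : ℂ) := by
  have hmonic := cyclotomic.monic n ℤ
  set R := P %ₘ cyclotomic n ℤ with hR
  have hcard : (primitiveRoots n ℂ).card = n.totient := Complex.card_primitiveRoots n
  have hdeg : (R.map (Int.castRingHom ℂ)).degree < (primitiveRoots n ℂ).card := by
    rw [hcard, ← degree_cyclotomic n ℤ]
    exact degree_map_le.trans_lt (degree_modByMonic_lt _ hmonic)
  have hconst : R.map (Int.castRingHom ℂ) = C c := by
    refine eq_of_degrees_lt_of_eval_finset_eq _ hdeg ?_ fun ξ hξ => ?_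
    · refine degree_C_le.trans_lt ?_
      rw [hcard]
      exact_mod_cast Nat.totient_pos.2 hn
    · have hroot : aeval ξ (cyclotomic n ℤ) = 0 := by
        have := (isPrimitiveRoot_of_mem_primitiveRoots hξ).isRoot_cyclotomic hn
        rwa [IsRoot.def, ← map_cyclotomic_int, eval_map, ← algebraMap_int_eq,
          ← aeval_def] at this
      have hmod : aeval ξ R = aeval ξ P :=
        aeval_modByMonic_eq_self_of_root hroot
      rw [eval_map, ← algebraMap_int_eq, ← aeval_def, hmod, h ξ hξ, eval_C]
  refine ⟨R.coeff 0, ?_⟩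
  simpa using (congrArg (fun p => p.coeff 0) hconst).symm

open Polynomial in
/-- An integer polynomial taking an integer value at a primitive `n`-th root of unity takes the same
value at its powers coprime to `n`. -/
theorem IsPrimitiveRoot.aeval_pow_eq_of_aeval_eq_intCast {n : ℕ} (hn : 0 < n) {ζ : ℂ}
    (hζ : IsPrimitiveRoot ζ n) {P : ℤ[X]} {m : ℤ} (h : aeval ζ P = (m : ℂ)) {k : ℕ}
    (hk : k.Coprime n) : aeval (ζ ^ k) P = (m : ℂ) := by
  have hdvd : minpoly ℤ ζ ∣ P - C m :=
    minpoly.isIntegrallyClosed_dvd (hζ.isIntegral hn) (by simp [h])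
  rw [hζ.minpoly_eq_pow_coprime hk] at hdvd
  have := aeval_eq_zero_of_dvd_aeval_eq_zero hdvd (minpoly.aeval ℤ (ζ ^ k))
  simpa [sub_eq_zero] using this

section AddChar

variable {G : Type*} [AddCommGroup G] [Fintype G]

/-- A function on a finite abelian group that is orthogonal to all characters vanishes. -/
theorem AddChar.eq_zero_of_forall_sum_mul_eq_zero (v : G → ℂ)
    (h : ∀ ψ : AddChar G ℂ, ∑ g, v g * ψ g = 0) : v = 0 := by
  classical
  let L : (G → ℂ) →ₗ[ℂ] ℂ := ∑ g, v g • LinearMap.proj g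
  have hL : L = 0 := (AddChar.complexBasis G).ext fun ψ => by simpa [L] using h ψ
  funext g
  simpa [L, Pi.single_apply] using LinearMap.congr_fun hL (Pi.single g 1)

open Polynomial in
/-- The values of a character sum at all multiples of a set are the values of one integer polynomial
at the powers of a root of unity. -/
theorem AddChar.exists_aeval_pow_eq_sum {ζ : ℂ} (hζ : IsPrimitiveRoot ζ (Fintype.card G))
    (ψ : AddChar G ℂ) (S : Finset G) :
    ∃ P : ℤ[X], ∀ k : ℕ, aeval (ζ ^ k) P = ∑ s ∈ S, ψ (k • s) := by
  have hpow (g : G) : ∃ i < Fintype.card G, ζ ^ i = ψ g := by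
    have : NeZero (Fintype.card G) := ⟨Fintype.card_ne_zero⟩
    refine hζ.eq_pow_of_pow_eq_one ?_
    rw [← AddChar.map_nsmul_eq_pow, card_nsmul_eq_zero, AddChar.map_zero_eq_one]
  choose a _ ha using hpow
  refine ⟨∑ s ∈ S, X ^ a s, fun k => ?_⟩
  simp only [map_sum, map_pow, aeval_X]
  exact Finset.sum_congr rfl fun s _ => by rw [AddChar.map_nsmul_eq_pow, ← ha s, pow_right_comm]

variable [DecidableEq G]

/-- If every character has the same sum over `S` as over the multiples `k • s`, then `S` is stable
under multiplication by `k`. -/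
theorem AddChar.nsmul_mem_of_sum_eq {S : Finset G} {k : ℕ}
    (h : ∀ ψ : AddChar G ℂ, ∑ s ∈ S, ψ (k • s) = ∑ s ∈ S, ψ s) {s : G} (hs : s ∈ S) :
    k • s ∈ S := by
  let v : G → ℂ := fun g => ((S.filter fun t => k • t = g).card : ℂ) - if g ∈ S then 1 else 0
  have hv : v = 0 := by
    refine AddChar.eq_zero_of_forall_sum_mul_eq_zero v fun ψ => ?_
    have hfiber : ∑ g, ((S.filter fun t => k • t = g).card : ℂ) * ψ g = ∑ s ∈ S, ψ (k • s) := by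
      rw [← Finset.sum_fiberwise S (fun t => k • t)]
      refine Finset.sum_congr rfl fun g _ => ?_
      rw [Finset.sum_congr rfl fun t ht => by rw [(Finset.mem_filter.1 ht).2]]
      simp
    simp [v, sub_mul, hfiber, h]
  by_contra hmem
  have h0 := congrFun hv (k • s)
  simp only [v, if_neg hmem, sub_zero, Pi.zero_apply, Nat.cast_eq_zero, Finset.card_eq_zero] at h0
  exact Finset.notMem_empty s (h0 ▸ Finset.mem_filter.2 ⟨hs, rfl⟩)

/-- The eigenvalues of a Cayley graph of a finite abelian group are the character sums over its
connection set. -/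
theorem AddChar.mem_spectrum_cayley_iff (S : Finset G) (μ : ℂ) :
    μ ∈ spectrum ℂ (Matrix.of fun g h : G => if h - g ∈ S then (1 : ℂ) else 0) ↔
      ∃ ψ : AddChar G ℂ, μ = ∑ s ∈ S, ψ s := by
  rw [← Matrix.spectrum_toLin', ← Module.End.hasEigenvalue_iff_mem_spectrum]
  constructor
  · intro hμ
    obtain ⟨v, hv⟩ := hμ.exists_hasEigenvector
    have hAv := hv.apply_eq_smul
    obtain ⟨ψ, hψ⟩ : ∃ ψ : AddChar G ℂ, ∑ g, v g * ψ g ≠ 0 := by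
      by_contra! hcon
      exact hv.2 (AddChar.eq_zero_of_forall_sum_mul_eq_zero v hcon)
    refine ⟨-ψ, mul_right_cancel₀ hψ ?_⟩
    have hcol (h : G) :
        ∑ g, (if h - g ∈ S then (1 : ℂ) else 0) * ψ g = (∑ s ∈ S, (-ψ) s) * ψ h := by
      rw [← (Equiv.subLeft h).sum_comp, Finset.sum_mul]
      simp [← AddChar.map_add_eq_mul, sub_eq_neg_add]
    calc μ * ∑ g, v g * ψ g
        = ∑ g, (Matrix.toLin' (Matrix.of fun g h : G => if h - g ∈ S then (1 : ℂ) else 0) v) g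
            * ψ g := by
          rw [hAv, Finset.mul_sum]
          simp [mul_assoc]
      _ = ∑ g, ∑ h, v h * ((if h - g ∈ S then (1 : ℂ) else 0) * ψ g) := by
          refine Finset.sum_congr rfl fun g _ => ?_
          rw [Matrix.toLin'_apply, Matrix.mulVec, dotProduct, Finset.sum_mul]
          refine Finset.sum_congr rfl fun h _ => ?_
          rw [Matrix.of_apply]
          ring
      _ = ∑ h, v h * ((∑ s ∈ S, (-ψ) s) * ψ h) := by
          rw [Finset.sum_comm]
          simp_rw [← Finset.mul_sum, hcol]
      _ = (∑ s ∈ S, (-ψ) s) * ∑ g, v g * ψ g := by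
          rw [Finset.mul_sum]
          exact Finset.sum_congr rfl fun h _ => by ring
  · rintro ⟨ψ, rfl⟩
    refine Module.End.hasEigenvalue_of_hasEigenvector (x := ψ)
      (Module.End.hasEigenvector_iff.2 ⟨Module.End.mem_eigenspace_iff.2 ?_, ψ.coe_ne_zero⟩)
    funext g
    rw [Matrix.toLin'_apply, Matrix.mulVec, dotProduct, ← Equiv.sum_comp (Equiv.addRight g)]
    simp [AddChar.map_add_eq_mul, Finset.sum_mul]

end AddChar

/-- **Theorem 1.** For a finite abelian group `G` of order `n` and a symmetric subset
`S ⊆ G` with `0 ∉ S`, the Cayley graph `D(G,S)` is integral (every eigenvalue of its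
adjacency matrix over `ℂ` is an integer) if and only if `S` is stable under the Galois
action `s ↦ k • s` for integers `k` coprime to `n`. -/
theorem integral_cayley_iff_galois_stable
    {G : Type*} [AddCommGroup G] [Fintype G] [DecidableEq G]
    (n : ℕ) (hn : n = Fintype.card G)
    (S : Finset G) (hsym : ∀ s ∈ S, -s ∈ S) (h0 : (0 : G) ∉ S) :
    (∀ μ ∈ spectrum ℂ (Matrix.of fun g h : G => if h - g ∈ S then (1 : ℂ) else 0),
        ∃ m : ℤ, μ = (m : ℂ)) ↔
      (∀ k : ℤ, Int.gcd k (n : ℤ) = 1 → ∀ s ∈ S, k • s ∈ S) := by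
  subst hn
  have hpos : 0 < Fintype.card G := Fintype.card_pos
  have hζ := Complex.isPrimitiveRoot_exp (Fintype.card G) hpos.ne'
  simp only [AddChar.mem_spectrum_cayley_iff, forall_exists_index, forall_eq_apply_imp_iff]
  constructor
  · intro hint
    have hnat (k : ℕ) (hk : k.Coprime (Fintype.card G)) (s : G) (hs : s ∈ S) : k • s ∈ S := by
      refine AddChar.nsmul_mem_of_sum_eq (fun ψ => ?_) hs
      obtain ⟨P, hP⟩ := AddChar.exists_aeval_pow_eq_sum hζ ψ S
      obtain ⟨m, hm⟩ := hint ψ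
      have h1 := hP 1
      simp only [pow_one, one_smul] at h1
      rw [← hP k, hm]
      exact hζ.aeval_pow_eq_of_aeval_eq_intCast hpos (h1.trans hm) hk
    intro k hk s hs
    obtain ⟨l, rfl | rfl⟩ := k.eq_nat_or_neg
    · rw [natCast_zsmul]
      exact hnat l (by simpa using hk) s hs
    · rw [neg_smul, natCast_zsmul]
      exact hsym _ (hnat l (by simpa using hk) s hs)
  · intro hstab ψ
    obtain ⟨P, hP⟩ := AddChar.exists_aeval_pow_eq_sum hζ ψ S
    refine exists_int_eq_of_aeval_primitiveRoots_eq hpos P _ fun ξ hξ => ?_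
    have : NeZero (Fintype.card G) := ⟨hpos.ne'⟩
    obtain ⟨k, -, hk, rfl⟩ :=
      hζ.isPrimitiveRoot_iff.1 (isPrimitiveRoot_of_mem_primitiveRoots hξ)
    have hinj : Function.Injective fun g : G => k • g :=
      (Nat.Coprime.nsmul_right_bijective (by simpa using hk.symm)).injective
    have himage : S.image (fun g => k • g) = S :=
      Finset.eq_of_subset_of_card_le
        (Finset.image_subset_iff.2 fun s hs => by
          simpa using hstab k (by simpa using hk) s hs)
        (Finset.card_image_of_injective S hinj).ge
    rw [hP k, ← Finset.sum_image (f := fun g => ψ g) hinj.injOn, himage]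
end

section
/- Let G be a finite abelian group of order n and let S ⊆ G be a symmetric subset with 0 ∉ S. If S is stable under the Galois action (for every integer k coprime to n and every s ∈ S, k • s ∈ S), then the Cayley graph D(G,S) is integral: every eigenvalue of its adjacency matrix over ℂ is an integer. -/
open Finset in
/-- The eigenvalues of a Cayley matrix on a finite abelian group are character sums over the
connection set. -/
lemma exists_addChar_sum_eq_of_mem_spectrum {G : Type*} [AddCommGroup G] [Fintype G]
    [DecidableEq G] (S : Finset G) {μ : ℂ}
    (hμ : μ ∈ spectrum ℂ (Matrix.of fun g h : G => if h - g ∈ S then (1 : ℂ) else 0)) :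
    ∃ ψ : AddChar G ℂ, μ = ∑ s ∈ S, ψ (-s) := by
  set A : Matrix G G ℂ := Matrix.of fun g h : G => if h - g ∈ S then (1 : ℂ) else 0 with hA
  rw [← Matrix.spectrum_toLin', ← Module.End.hasEigenvalue_iff_mem_spectrum] at hμ
  obtain ⟨v, hv⟩ := hμ.exists_hasEigenvector
  have hAv : A.mulVec v = μ • v := by simpa using hv.apply_eq_smul
  have hcol (ψ : AddChar G ℂ) : Matrix.vecMul (ψ : G → ℂ) A = (∑ s ∈ S, ψ (-s)) • (ψ : G → ℂ) := by
    ext h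
    calc ∑ g, ψ g * A g h = ∑ s, ψ (h - s) * A (h - s) h :=
          ((Equiv.subLeft h).sum_comp fun g => ψ g * A g h).symm
      _ = ∑ s ∈ S, ψ (-s) * ψ h := by
          simp [hA, sub_eq_neg_add, AddChar.map_add_eq_mul]
      _ = _ := by simp [sum_mul]
  obtain ⟨ψ, hψ⟩ : ∃ ψ : AddChar G ℂ, (ψ : G → ℂ) ⬝ᵥ v ≠ 0 := by
    by_contra! h
    have hz : (dotProductBilin ℂ ℂ).flip v = (0 : (G → ℂ) →ₗ[ℂ] ℂ) :=
      (AddChar.complexBasis G).ext fun ψ => by simpa using h ψ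
    refine hv.2 (dotProduct_eq_zero v fun w => ?_)
    rw [dotProduct_comm]
    simpa using LinearMap.congr_fun hz w
  refine ⟨ψ, mul_right_cancel₀ hψ ?_⟩
  have := Matrix.dotProduct_mulVec (ψ : G → ℂ) A v
  rwa [hAv, hcol, dotProduct_smul, smul_dotProduct, smul_eq_mul, smul_eq_mul] at this

open Finset IntermediateField in
/-- A character sum over a set stable under multiplication by integers coprime to the group order
is an integer. -/
lemma exists_intCast_eq_sum_addChar {G : Type*} [AddCommGroup G] [Fintype G] [DecidableEq G]
    (S : Finset G) (hstable : ∀ k : ℕ, k.Coprime (Fintype.card G) → ∀ s ∈ S, k • s ∈ S)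
    (ψ : AddChar G ℂ) : ∃ m : ℤ, ∑ s ∈ S, ψ s = (m : ℂ) := by
  set n := Fintype.card G with hn
  have : NeZero n := ⟨Fintype.card_ne_zero⟩
  have hpow (g : G) : ψ g ^ n = 1 := by
    rw [← AddChar.map_nsmul_eq_pow, hn, card_nsmul_eq_zero, AddChar.map_zero_eq_one]
  obtain ⟨ζ, hζ⟩ : ∃ ζ : ℂ, IsPrimitiveRoot ζ n := ⟨_, Complex.isPrimitiveRoot_exp n (NeZero.ne n)⟩
  have : IsCyclotomicExtension {n} ℚ ℚ⟮ζ⟯ :=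
    (isCyclotomicExtension_singleton_iff_eq_adjoin n ℚ ℂ ℚ⟮ζ⟯ hζ).2 rfl
  have : IsGalois ℚ ℚ⟮ζ⟯ := IsCyclotomicExtension.isGalois {n} ℚ ℚ⟮ζ⟯
  have : FiniteDimensional ℚ ℚ⟮ζ⟯ := IsCyclotomicExtension.finiteDimensional {n} ℚ ℚ⟮ζ⟯
  let z : ℚ⟮ζ⟯ := AdjoinSimple.gen ℚ ζ
  have hz : IsPrimitiveRoot z n := IsPrimitiveRoot.coe_submonoidClass_iff.1 hζ
  choose e _ he using fun g => hζ.eq_pow_of_pow_eq_one (hpow g)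
  have hfix (σ : Gal(ℚ⟮ζ⟯/ℚ)) : σ (∑ s ∈ S, z ^ e s) = ∑ s ∈ S, z ^ e s := by
    obtain ⟨k, -, hk, hσ⟩ := (hz.isPrimitiveRoot_iff).1 (hz.map_of_injective σ.injective)
    apply Subtype.val_injective
    have hbij : Set.BijOn (fun s => k • s) (S : Set G) S := by
      have hinj : Set.InjOn (fun s => k • s) (S : Set G) := by
        refine Function.Injective.injOn (nsmulCoprime ?_).injective
        rw [Nat.card_eq_fintype_card]
        exact hk.symm
      exact ⟨hstable k hk, hinj, surjOn_of_injOn_of_card_le _ (hstable k hk) hinj le_rfl⟩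
    calc ((σ (∑ s ∈ S, z ^ e s) : ℚ⟮ζ⟯) : ℂ) = ∑ s ∈ S, ψ (k • s) := by
          simp_rw [AddChar.map_nsmul_eq_pow, ← he]
          simp [← hσ, z, pow_right_comm ζ k]
      _ = ∑ s ∈ S, ψ s :=
          sum_nbij (fun s => k • s) hbij.mapsTo hbij.injOn hbij.surjOn fun _ _ => rfl
      _ = _ := by simp [← he, z]
  obtain ⟨q, hq⟩ := (IsGalois.mem_range_algebraMap_iff_fixed (F := ℚ) _).2 hfix
  have hq' : algebraMap ℚ ℂ q = ∑ s ∈ S, ψ s := by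
    simpa [← he, z] using congrArg (algebraMap ℚ⟮ζ⟯ ℂ) hq
  have hint : IsIntegral ℤ (∑ s ∈ S, ψ s) :=
    IsIntegral.sum _ fun s _ => IsIntegral.of_pow (NeZero.pos n) (hpow s ▸ isIntegral_one)
  rw [← hq', isIntegral_algebraMap_iff (algebraMap ℚ ℂ).injective] at hint
  obtain ⟨m, rfl⟩ := IsIntegrallyClosed.isIntegral_iff.1 hint
  exact ⟨m, by simp [← hq']⟩

/-- **Proposition 1.** If `S` is a symmetric subset of a finite abelian group `G` of
order `n` with `0 ∉ S`, and `S` is stable under the Galois action (`k • s ∈ S` for all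
integers `k` coprime to `n` and `s ∈ S`), then the Cayley graph `D(G,S)` is integral:
every eigenvalue of its adjacency matrix over `ℂ` is an integer. -/
theorem integral_cayley_of_galois_stable
    {G : Type*} [AddCommGroup G] [Fintype G] [DecidableEq G]
    (n : ℕ) (hn : n = Fintype.card G)
    (S : Finset G) (hsym : ∀ s ∈ S, -s ∈ S) (h0 : (0 : G) ∉ S)
    (hstable : ∀ k : ℤ, Int.gcd k (n : ℤ) = 1 → ∀ s ∈ S, k • s ∈ S) :
    ∀ μ ∈ spectrum ℂ (Matrix.of fun g h : G => if h - g ∈ S then (1 : ℂ) else 0),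
      ∃ m : ℤ, μ = (m : ℂ) := by
  intro μ hμ
  obtain ⟨ψ, rfl⟩ := exists_addChar_sum_eq_of_mem_spectrum S hμ
  obtain ⟨m, hm⟩ := exists_intCast_eq_sum_addChar S
    (fun k hk s hs => by
      simpa using hstable k (by rwa [hn, Int.gcd_natCast_natCast]) s hs) ψ
  refine ⟨m, hm ▸ ?_⟩
  exact Finset.sum_nbij' (fun s => -s) (fun s => -s) hsym hsym (by simp) (by simp) (by simp)
end

section
/- Let G be a finite abelian group of order n and let S ⊆ G be a symmetric subset with 0 ∉ S. If the Cayley graph D(G,S) is integral (every eigenvalue of its adjacency matrix over ℂ is an integer), then S is stable under the Galois action: for every integer k coprime to n and every s ∈ S, k • s ∈ S. -/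
/-- Character sums are eigenvalues of Cayley matrices. -/
lemma addChar_sum_mem_spectrum {G : Type*} [AddCommGroup G] [Fintype G] [DecidableEq G]
    (S : Finset G) (χ : AddChar G ℂ) :
    ∑ s ∈ S, χ s ∈ spectrum ℂ (Matrix.of fun g h : G => if h - g ∈ S then (1 : ℂ) else 0) := by
  rw [← Matrix.spectrum_toLin']
  apply Module.End.HasEigenvalue.mem_spectrum
  apply Module.End.hasEigenvalue_of_hasEigenvector (x := (χ : G → ℂ))
  refine ⟨Module.End.mem_eigenspace_iff.mpr ?_, fun h => by simpa using congrFun h 0⟩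
  ext g
  simp only [Matrix.toLin'_apply, Matrix.mulVec, dotProduct, Matrix.of_apply, ite_mul, one_mul,
    zero_mul, Pi.smul_apply, smul_eq_mul]
  rw [← Equiv.sum_comp (Equiv.addRight g)]
  simp [AddChar.map_add_eq_mul, Finset.sum_mul]

/-- An integral relation among powers of a primitive root of unity is preserved by raising the
root to a power coprime to its order. -/
lemma sum_pow_eq_intCast_of_isPrimitiveRoot {ι : Type*} {n : ℕ} (hn : 0 < n) {ζ : ℂ}
    (hζ : IsPrimitiveRoot ζ n) {j : ℕ} (hj : j.Coprime n) (S : Finset ι) (a : ι → ℕ) (m : ℤ)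
    (h : ∑ i ∈ S, ζ ^ a i = m) : ∑ i ∈ S, (ζ ^ j) ^ a i = m := by
  set p : Polynomial ℤ := ∑ i ∈ S, Polynomial.X ^ a i - Polynomial.C m
  have hp : Polynomial.aeval ζ p = 0 := by simp [p, h]
  have hd : minpoly ℤ ζ ∣ p := minpoly.isIntegrallyClosed_dvd (hζ.isIntegral hn) hp
  rw [hζ.minpoly_eq_pow_coprime hj] at hd
  have := Polynomial.aeval_eq_zero_of_dvd_aeval_eq_zero hd (minpoly.aeval ℤ (ζ ^ j))
  simpa [p, sub_eq_zero] using this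

/-- An integral character sum is invariant under multiplication by integers coprime to the order
of the group. -/
lemma AddChar.sum_zsmul_eq_of_sum_eq_intCast {G : Type*} [AddCommGroup G] [Fintype G]
    (S : Finset G) (χ : AddChar G ℂ) (m : ℤ) (h : ∑ s ∈ S, χ s = m) (k : ℤ)
    (hk : Int.gcd k (Fintype.card G) = 1) : ∑ s ∈ S, χ (k • s) = m := by
  have hn : 0 < Fintype.card G := Fintype.card_pos
  have hζ := Complex.isPrimitiveRoot_exp _ hn.ne'
  set ζ := Complex.exp (2 * Real.pi * Complex.I / Fintype.card G)
  have hχ (g : G) : ∃ a : ℕ, ζ ^ a = χ g := by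
    have : NeZero (Fintype.card G) := ⟨hn.ne'⟩
    have h1 : χ g ^ Fintype.card G = 1 := by
      rw [← AddChar.map_nsmul_eq_pow, card_nsmul_eq_zero, AddChar.map_zero_eq_one]
    obtain ⟨i, -, hi⟩ := hζ.eq_pow_of_pow_eq_one h1
    exact ⟨i, hi⟩
  choose a ha using hχ
  obtain ⟨j, hj⟩ := Int.eq_ofNat_of_zero_le (Int.emod_nonneg k (Int.natCast_ne_zero.mpr hn.ne'))
  have hjc : j.Coprime (Fintype.card G) := by
    rw [← Int.isCoprime_iff_gcd_eq_one] at hk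
    rw [← Nat.isCoprime_iff_coprime, ← hj, Int.emod_def, sub_eq_add_neg, ← mul_neg]
    exact hk.add_mul_left_left _
  have hks (g : G) : k • g = j • g := by
    rw [← natCast_zsmul, ← hj, ← mod_card_zsmul]
  rw [← sum_pow_eq_intCast_of_isPrimitiveRoot hn hζ hjc S a m (by simpa [ha] using h)]
  refine Finset.sum_congr rfl fun s _ => ?_
  rw [hks, AddChar.map_nsmul_eq_pow, ← ha, pow_right_comm]


/-- **Proposition 2.** If the Cayley graph `D(G,S)` on a finite abelian group `G` of
order `n` (with `S` symmetric, `0 ∉ S`) is integral, then `S` is stable under the Galois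
action: `k • s ∈ S` for every integer `k` coprime to `n` and every `s ∈ S`. -/
theorem galois_stable_of_integral_cayley
    {G : Type*} [AddCommGroup G] [Fintype G] [DecidableEq G]
    (n : ℕ) (hn : n = Fintype.card G)
    (S : Finset G) (hsym : ∀ s ∈ S, -s ∈ S) (h0 : (0 : G) ∉ S)
    (hint : ∀ μ ∈ spectrum ℂ (Matrix.of fun g h : G => if h - g ∈ S then (1 : ℂ) else 0),
      ∃ m : ℤ, μ = (m : ℂ)) :
    ∀ k : ℤ, Int.gcd k (n : ℤ) = 1 → ∀ s ∈ S, k • s ∈ S := by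
  subst hn
  intro k hk t ht
  have hχ (χ : AddChar G ℂ) : ∑ s ∈ S, χ (k • s) = ∑ s ∈ S, χ s := by
    obtain ⟨m, hm⟩ := hint _ (addChar_sum_mem_spectrum S χ)
    rw [hm, χ.sum_zsmul_eq_of_sum_eq_intCast S m hm k hk]
  have hcount : ∑ s ∈ S, (if k • s - k • t = 0 then (Fintype.card G : ℂ) else 0) =
      ∑ s ∈ S, if s - k • t = 0 then (Fintype.card G : ℂ) else 0 := by
    simp_rw [← AddChar.sum_apply_eq_ite]
    rw [Finset.sum_comm, Finset.sum_comm (s := S)]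
    refine Finset.sum_congr rfl fun χ _ => ?_
    simp_rw [sub_eq_add_neg, AddChar.map_add_eq_mul, ← Finset.sum_mul, hχ]
  by_contra hkt
  have hR : ∑ s ∈ S, (if s - k • t = 0 then (Fintype.card G : ℂ) else 0) = 0 :=
    Finset.sum_eq_zero fun s hs => if_neg fun h => hkt (by rwa [← sub_eq_zero.mp h])
  rw [hR, ← Finset.sum_filter, Finset.sum_const, smul_eq_zero] at hcount
  rcases hcount with h | h
  · exact Finset.card_ne_zero_of_mem (Finset.mem_filter.mpr ⟨ht, sub_self (k • t)⟩) h
  · exact Fintype.card_ne_zero (Nat.cast_eq_zero.mp h)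
end

section
/- Let G be a finite abelian group. The family of nontrivial complex additive characters of G, viewed as functions on G ∖ {0} (i.e. for each nontrivial additive character ψ : G → ℂ the function sending a nonzero g ∈ G to ψ(g)), is linearly independent over ℂ. Equivalently, the square matrix indexed by nontrivial characters and nonzero group elements, with entry ψ(g) in row ψ and column g, is nonsingular. -/
/-- **Lemma 1.** For a finite abelian group `G`, the nontrivial complex additive
characters of `G`, viewed as functions on `G ∖ {0}`, are linearly independent over `ℂ`;
equivalently, the matrix `Γ = (ψ g)` with rows indexed by nontrivial characters `ψ` and
columns indexed by nonzero elements `g` is nonsingular. -/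
theorem nontrivial_addChars_linearIndependent_on_nonzero
    {G : Type*} [AddCommGroup G] [Fintype G] :
    LinearIndependent ℂ
      (fun ψ : {ψ : AddChar G ℂ // ψ ≠ 1} => fun g : {g : G // g ≠ 0} => ψ.1 g.1) := by
  have h_indep : LinearIndependent ℂ (fun ψ : {ψ : AddChar G ℂ // ψ ≠ 1} => (ψ.1 : G → ℂ)) :=
    (AddChar.linearIndependent G ℂ).comp _ Subtype.val_injective
  rw [linearIndependent_iff'] at h_indep ⊢
  intro s c hc
  apply h_indep s c
  have h_ne (g : G) (hg : g ≠ 0) : ∑ ψ ∈ s, c ψ * ψ.1 g = 0 := by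
    simpa using congrFun hc ⟨g, hg⟩
  have h_sum : ∑ g : G, ∑ ψ ∈ s, c ψ * ψ.1 g = 0 := by
    rw [Finset.sum_comm]
    refine Finset.sum_eq_zero fun ψ _ => ?_
    rw [← Finset.mul_sum, AddChar.sum_eq_zero_iff_ne_zero.2 ψ.2, mul_zero]
  rw [Fintype.sum_eq_single 0 h_ne] at h_sum
  ext g
  obtain rfl | hg := eq_or_ne g 0
  · simpa using h_sum
  · simpa using h_ne g hg
end

section
/- Let G be a finite abelian group of order n and let ω : G → ℚ be a function with ω(0) = 0. Then the following are equivalent: (i) for every complex additive character ψ of G, the sum Σ_{g ∈ G} ω(g) · ψ(g) is a rational number; (ii) ω is constant on Galois orbits, i.e. for every integer k coprime to n and every g ∈ G, ω(k • g) = ω(g). -/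
open IsCyclotomicExtension in
/-- A rational combination of complex `n`-th roots of unity is rational if and only if it is
unchanged by raising all these roots to any power prime to `n`. -/
theorem exists_rat_eq_sum_rootsOfUnity_iff {ι : Type*} [Fintype ι] (n : ℕ) [NeZero n]
    (w : ι → ℚ) (z : ι → ℂ) (hz : ∀ i, z i ^ n = 1) :
    (∃ q : ℚ, ∑ i, (w i : ℂ) * z i = q) ↔
      ∀ u : (ZMod n)ˣ, ∑ i, (w i : ℂ) * z i ^ (u : ZMod n).val = ∑ i, (w i : ℂ) * z i := by
  let L := CyclotomicField n ℚ
  have : IsCyclotomicExtension {n} ℚ L := CyclotomicField.isCyclotomicExtension n ℚ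
  have hζ : IsPrimitiveRoot (zeta n ℚ L) n := zeta_spec n ℚ L
  let e : L →ₐ[ℚ] ℂ := IsAlgClosed.lift
  have he : Function.Injective e := e.injective
  have hy (i : ι) : ∃ y : L, y ^ n = 1 ∧ e y = z i := by
    obtain ⟨a, -, ha⟩ := (hζ.map_of_injective he).eq_pow_of_pow_eq_one (hz i)
    exact ⟨zeta n ℚ L ^ a, by rw [← pow_mul, mul_comm, pow_mul, hζ.pow_eq_one, one_pow],
      by rw [map_pow, ha]⟩
  choose y hyn hye using hy
  have e_sum (m : ℕ) : e (∑ i, algebraMap ℚ L (w i) * y i ^ m) = ∑ i, (w i : ℂ) * z i ^ m := by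
    simp [hye]
  have e_sum_one : e (∑ i, algebraMap ℚ L (w i) * y i) = ∑ i, (w i : ℂ) * z i := by
    simpa using e_sum 1
  have gal_apply (σ : Gal(L/ℚ)) (i : ι) : σ (y i) = y i ^ (hζ.autToPow ℚ σ : ZMod n).val := by
    obtain ⟨a, -, ha⟩ := hζ.eq_pow_of_pow_eq_one (hyn i)
    rw [← ha, map_pow, ← hζ.autToPow_spec ℚ σ, ← pow_mul, ← pow_mul, mul_comm]
  have gal_sum (σ : Gal(L/ℚ)) : σ (∑ i, algebraMap ℚ L (w i) * y i) =
      ∑ i, algebraMap ℚ L (w i) * y i ^ (hζ.autToPow ℚ σ : ZMod n).val := by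
    simp only [map_sum, map_mul, AlgEquiv.commutes, gal_apply]
  have : IsGalois ℚ L := IsCyclotomicExtension.isGalois {n} ℚ L
  have : FiniteDimensional ℚ L := IsCyclotomicExtension.finiteDimensional {n} ℚ L
  have rational_iff : (∃ q : ℚ, ∑ i, (w i : ℂ) * z i = q) ↔
      ∑ i, algebraMap ℚ L (w i) * y i ∈ Set.range (algebraMap ℚ L) := by
    rw [← e_sum_one]
    refine exists_congr fun q ↦ ?_
    rw [show (q : ℂ) = e (algebraMap ℚ L q) by simp, he.eq_iff, eq_comm]
  rw [rational_iff, IsGalois.mem_range_algebraMap_iff_fixed]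
  constructor
  · intro h u
    obtain ⟨σ, hσ⟩ := (autEquivPow L
      (Polynomial.cyclotomic.irreducible_rat (NeZero.pos n))).surjective u
    replace hσ : hζ.autToPow ℚ σ = u := hσ
    rw [← e_sum, ← e_sum_one, ← hσ, ← gal_sum, h]
  · intro h σ
    apply he
    rw [gal_sum, e_sum, e_sum_one, h]

/-- A function on a finite abelian group is determined by its character sums. -/
theorem AddChar.eq_of_sum_mul_apply_eq {G : Type*} [AddCommGroup G] [Fintype G] {f₁ f₂ : G → ℂ}
    (h : ∀ ψ : AddChar G ℂ, ∑ g, f₁ g * ψ g = ∑ g, f₂ g * ψ g) : f₁ = f₂ := by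
  classical
  have key : Fintype.linearCombination ℂ f₁ = Fintype.linearCombination ℂ f₂ :=
    (AddChar.complexBasis G).ext fun ψ ↦ by
      simpa [Fintype.linearCombination_apply, mul_comm] using h ψ
  funext g
  simpa using LinearMap.congr_fun key (Pi.single g 1)

/-- **Lemma 2.** Let `G` be a finite abelian group of order `n` and `ω : G → ℚ` with
`ω 0 = 0`. Then all the character sums `∑ g, ω g • ψ g` (for complex additive characters
`ψ` of `G`) are rational if and only if `ω` is constant on Galois orbits, i.e.
`ω (k • g) = ω g` for every integer `k` coprime to `n` and every `g ∈ G`. -/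
theorem rational_character_sums_iff_constant_on_orbits
    {G : Type*} [AddCommGroup G] [Fintype G]
    (n : ℕ) (hn : n = Fintype.card G)
    (ω : G → ℚ) (h0 : ω 0 = 0) :
    (∀ ψ : AddChar G ℂ, ∃ q : ℚ, ∑ g : G, (ω g : ℂ) * ψ g = (q : ℂ)) ↔
      (∀ k : ℤ, Int.gcd k (n : ℤ) = 1 → ∀ g : G, ω (k • g) = ω g) := by
  subst hn
  let _ : Module (ZMod (Fintype.card G)) G :=
    AddCommGroup.zmodModule fun g ↦ card_nsmul_eq_zero
  have val_nsmul (u : (ZMod (Fintype.card G))ˣ) (g : G) :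
      (u : ZMod (Fintype.card G)).val • g = u • g := by
    rw [← Nat.cast_smul_eq_nsmul (ZMod (Fintype.card G)), ZMod.natCast_zmod_val, Units.smul_def]
  have sum_rational_iff (ψ : AddChar G ℂ) : (∃ q : ℚ, ∑ g, (ω g : ℂ) * ψ g = q) ↔
      ∀ u : (ZMod (Fintype.card G))ˣ,
        ∑ g, (ω (u⁻¹ • g) : ℂ) * ψ g = ∑ g, (ω g : ℂ) * ψ g := by
    rw [exists_rat_eq_sum_rootsOfUnity_iff (Fintype.card G) ω ψ fun g ↦ by
      rw [← AddChar.map_nsmul_eq_pow, card_nsmul_eq_zero, AddChar.map_zero_eq_one]]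
    refine forall_congr' fun u ↦ ?_
    rw [← Equiv.sum_comp (MulAction.toPerm u) fun g ↦ (ω (u⁻¹ • g) : ℂ) * ψ g]
    simp only [MulAction.toPerm_apply, inv_smul_smul, ← AddChar.map_nsmul_eq_pow, val_nsmul]
  simp only [sum_rational_iff]
  constructor
  · intro h k hk g
    obtain ⟨u, hu⟩ := (ZMod.coe_int_isUnit_iff_isCoprime k (Fintype.card G)).2
      (Int.isCoprime_iff_gcd_eq_one.2 hk).symm
    have := congrFun (AddChar.eq_of_sum_mul_apply_eq fun ψ ↦ h ψ u⁻¹) g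
    rwa [inv_inv, Units.smul_def, hu, Int.cast_smul_eq_zsmul, Rat.cast_inj] at this
  · intro h ψ u
    refine Finset.sum_congr rfl fun g _ ↦ ?_
    rw [← val_nsmul, ← natCast_zsmul, h _ (by
      simpa only [Int.gcd_natCast_natCast] using ZMod.val_coe_unit_coprime u⁻¹)]
end

section
/- Let G be a finite abelian group of order n, and let r(G) denote the number of Galois orbits of the action of integers coprime to n on G ∖ {0}. Then the number of symmetric subsets S ⊆ G with 0 ∉ S for which the Cayley graph D(G,S) is integral is at most 2^{r(G)}. -/
/-- Two sums of powers of a root of unity with an integral value agree after raising the root to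
an exponent coprime to its order. -/
theorem IsPrimitiveRoot.sum_pow_coprime_eq {ι : Type*} {n : ℕ} (hn : 0 < n) {ζ : ℂ}
    (hζ : IsPrimitiveRoot ζ n) {k : ℕ} (hk : k.Coprime n) (s : Finset ι) (a : ι → ℕ) {m : ℤ}
    (h : ∑ i ∈ s, ζ ^ a i = m) : ∑ i ∈ s, (ζ ^ k) ^ a i = m := by
  let P : Polynomial ℤ := ∑ i ∈ s, Polynomial.X ^ a i - Polynomial.C m
  have hP : Polynomial.aeval ζ P = 0 := by simp [P, h]
  have hdvd : minpoly ℤ ζ ∣ P := minpoly.isIntegrallyClosed_dvd (hζ.isIntegral hn) hP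
  rw [hζ.minpoly_eq_pow_coprime hk] at hdvd
  have hroot : Polynomial.aeval (ζ ^ k) P = 0 :=
    Polynomial.aeval_eq_zero_of_dvd_aeval_eq_zero hdvd (minpoly.aeval ℤ _)
  simpa [P, sub_eq_zero] using hroot

section Cayley

variable {G : Type*} [AddCommGroup G] [Fintype G]

/-- Character sums over the connection set are eigenvalues of the Cayley graph. -/
theorem AddChar.sum_mem_spectrum_cayley [DecidableEq G] (S : Finset G) (χ : AddChar G ℂ) :
    ∑ s ∈ S, χ s ∈
      spectrum ℂ (Matrix.of fun g h : G => if h - g ∈ S then (1 : ℂ) else 0) := by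
  rw [← Matrix.spectrum_toLin', ← Module.End.hasEigenvalue_iff_mem_spectrum]
  refine Module.End.hasEigenvalue_of_hasEigenvector (x := χ) ⟨?_, ?_⟩
  · rw [Module.End.mem_eigenspace_iff]
    ext g
    simp only [Matrix.toLin'_apply, Matrix.mulVec, dotProduct, Matrix.of_apply, ite_mul, one_mul,
      zero_mul, Pi.smul_apply, smul_eq_mul]
    rw [← Equiv.sum_comp (Equiv.addRight g)]
    simp [AddChar.map_add_eq_mul, Finset.sum_mul]
  · intro h
    simpa using congrFun h 0

/-- An integral character sum is invariant under multiplying its terms by an integer coprime to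
the order of the group. -/
theorem AddChar.sum_nsmul_eq_of_coprime (S : Finset G) (χ : AddChar G ℂ) {k : ℕ}
    (hk : k.Coprime (Fintype.card G)) {m : ℤ} (h : ∑ s ∈ S, χ s = m) :
    ∑ s ∈ S, χ (k • s) = m := by
  have hn : 0 < Fintype.card G := Fintype.card_pos
  have hζ := Complex.isPrimitiveRoot_exp _ hn.ne'
  have : NeZero (Fintype.card G) := ⟨hn.ne'⟩
  have hpow (s : G) : ∃ a : ℕ, Complex.exp (2 * Real.pi * Complex.I / Fintype.card G) ^ a = χ s := by
    have h1 : χ s ^ Fintype.card G = 1 := by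
      rw [← AddChar.map_nsmul_eq_pow, card_nsmul_eq_zero, AddChar.map_zero_eq_one]
    obtain ⟨a, -, ha⟩ := hζ.eq_pow_of_pow_eq_one h1
    exact ⟨a, ha⟩
  choose a ha using hpow
  have := hζ.sum_pow_coprime_eq hn hk S a (m := m) (by simpa only [ha] using h)
  rw [← this]
  refine Finset.sum_congr rfl fun s _ => ?_
  rw [AddChar.map_nsmul_eq_pow, ← ha, pow_right_comm]

/-- If all character sums over `S` are integers, then `S` is stable under multiplication by
integers coprime to the order of the group. -/
theorem nsmul_mem_of_integral_sums [DecidableEq G] {S : Finset G}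
    (h : ∀ χ : AddChar G ℂ, ∃ m : ℤ, ∑ s ∈ S, χ s = m) {k : ℕ}
    (hk : k.Coprime (Fintype.card G)) {g : G} (hg : g ∈ S) : k • g ∈ S := by
  have key : ∀ f : G → G, ∑ χ : AddChar G ℂ, χ (-(k • g)) * ∑ s ∈ S, χ (f s) =
      Fintype.card G * (S.filter fun s => f s = k • g).card := by
    intro f
    simp_rw [Finset.mul_sum, ← AddChar.map_add_eq_mul]
    rw [Finset.sum_comm]
    simp [AddChar.sum_apply_eq_ite, neg_add_eq_zero, eq_comm, Finset.sum_ite, mul_comm]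
  have heq : (Fintype.card G : ℂ) * (S.filter fun s => s = k • g).card =
      Fintype.card G * (S.filter fun s => k • s = k • g).card := by
    rw [← key fun s => s, ← key fun s => k • s]
    refine Finset.sum_congr rfl fun χ _ => ?_
    obtain ⟨m, hm⟩ := h χ
    rw [χ.sum_nsmul_eq_of_coprime S hk hm, hm]
  have hcard := mul_left_cancel₀ (Nat.cast_ne_zero.mpr Fintype.card_ne_zero) heq
  have hpos : 0 < (S.filter fun s => k • s = k • g).card :=
    Finset.card_pos.mpr ⟨g, by simp [hg]⟩
  rw [← Nat.cast_inj.mp hcard] at hpos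
  obtain ⟨x, hx⟩ := Finset.card_pos.mp hpos
  obtain ⟨hxS, rfl⟩ := Finset.mem_filter.mp hx
  exact hxS

/-- The connection set of an integral Cayley graph is a union of Galois orbits. -/
theorem zsmul_mem_of_integral_cayley [DecidableEq G] {S : Finset G}
    (h : ∀ μ ∈ spectrum ℂ (Matrix.of fun g h : G => if h - g ∈ S then (1 : ℂ) else 0),
      ∃ m : ℤ, μ = (m : ℂ)) {k : ℤ} (hk : Int.gcd k (Fintype.card G) = 1) {g : G}
    (hg : g ∈ S) : k • g ∈ S := by
  have hn : (Fintype.card G : ℤ) ≠ 0 := Nat.cast_ne_zero.mpr Fintype.card_ne_zero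
  obtain ⟨j, hj⟩ := Int.eq_ofNat_of_zero_le (Int.emod_nonneg k hn)
  have hjk : j • g = k • g := by
    rw [← natCast_zsmul, ← hj, mod_card_zsmul]
  have hcop : j.Coprime (Fintype.card G) := by
    rw [Nat.Coprime, ← Int.gcd_natCast_natCast, ← hj, Int.gcd_emod, hk]
  rw [← hjk]
  exact nsmul_mem_of_integral_sums (fun χ => h _ (χ.sum_mem_spectrum_cayley S)) hcop hg

end Cayley


/-- **Corollary 1.** Let `G` be a finite abelian group of order `n` and let `r(G)` be
the number of Galois orbits (orbits of the action `g ↦ k • g` of the integers `k`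
coprime to `n`) on `G ∖ {0}`. Then the number of symmetric subsets `S ⊆ G` with
`0 ∉ S` whose Cayley graph `D(G,S)` is integral is at most `2 ^ r(G)`. -/
theorem card_integral_cayley_le_two_pow_orbits
    {G : Type*} [AddCommGroup G] [Fintype G] [DecidableEq G]
    (n : ℕ) (hn : n = Fintype.card G) :
    Set.ncard {S : Finset G | (∀ s ∈ S, -s ∈ S) ∧ (0 : G) ∉ S ∧
        ∀ μ ∈ spectrum ℂ (Matrix.of fun g h : G => if h - g ∈ S then (1 : ℂ) else 0),
          ∃ m : ℤ, μ = (m : ℂ)} ≤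
      2 ^ Set.ncard {O : Set G | ∃ g : G, g ≠ 0 ∧
        O = {x : G | ∃ k : ℤ, Int.gcd k (n : ℤ) = 1 ∧ k • g = x}} := by
  subst hn
  rw [← Set.ncard_powerset _ (Set.toFinite _)]
  refine Set.ncard_le_ncard_of_injOn
    (fun S => {O | (∃ g : G, g ≠ 0 ∧
      O = {x : G | ∃ k : ℤ, Int.gcd k (Fintype.card G : ℤ) = 1 ∧ k • g = x}) ∧ O ⊆ ↑S})
    (fun S _ O hO => hO.1) ?_ (Set.toFinite _)
  have hsub {S T : Finset G} (h0 : (0 : G) ∉ S)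
      (hS : ∀ μ ∈ spectrum ℂ (Matrix.of fun g h : G => if h - g ∈ S then (1 : ℂ) else 0),
        ∃ m : ℤ, μ = (m : ℂ))
      (hST : ∀ O : Set G, (∃ g : G, g ≠ 0 ∧
        O = {x : G | ∃ k : ℤ, Int.gcd k (Fintype.card G : ℤ) = 1 ∧ k • g = x}) →
          O ⊆ ↑S → O ⊆ ↑T) : S ⊆ T := by
    intro g hg
    refine hST _ ⟨g, fun h => h0 (h ▸ hg), rfl⟩ ?_ ⟨1, by simp, one_zsmul g⟩
    rintro _ ⟨k, hk, rfl⟩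
    exact zsmul_mem_of_integral_cayley hS hk hg
  rintro S ⟨-, hS0, hS⟩ T ⟨-, hT0, hT⟩ hST
  exact (hsub hS0 hS fun O hO hOS => (hST.subset ⟨hO, hOS⟩).2).antisymm
    (hsub hT0 hT fun O hO hOT => (hST.superset ⟨hO, hOT⟩).2)
end

section
/- Let n > 1 and let S ⊆ ℤ/nℤ be a symmetric subset with 0 ∉ S. The Cayley graph (circulant graph) D(ℤ/nℤ, S) is integral if and only if S is a union of the sets G_n(d) = { k : 0 < k < n, gcd(k, n) = d }; equivalently, if and only if for all nonzero x, y ∈ ℤ/nℤ with gcd(x, n) = gcd(y, n) (gcd taken of the canonical representatives with n), x ∈ S implies y ∈ S. -/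
section

open ZMod Polynomial

variable {n : ℕ} [NeZero n]

/-- The indicator function of `S`, with complex values. -/
noncomputable def complexIndicator (S : Finset (ZMod n)) (j : ZMod n) : ℂ :=
  if j ∈ S then 1 else 0

lemma isPrimitiveRoot_stdAddChar_one : IsPrimitiveRoot (stdAddChar (1 : ZMod n) : ℂ) n := by
  have h := stdAddChar_coe (N := n) 1
  rw [Int.cast_one] at h
  rw [h, Int.cast_one, mul_one]
  exact Complex.isPrimitiveRoot_exp n (NeZero.ne n)

lemma stdAddChar_eq_pow_val (j : ZMod n) :
    (stdAddChar j : ℂ) = stdAddChar (1 : ZMod n) ^ j.val := by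
  rw [← AddChar.map_nsmul_eq_pow, nsmul_one, natCast_zmod_val]

lemma dft_complexIndicator_natCast_mul (S : Finset (ZMod n)) (a : ℕ) (k : ZMod n) :
    𝓕 (complexIndicator S) (a * k) =
      ∑ j ∈ S, ((stdAddChar (1 : ZMod n) : ℂ) ^ a) ^ (-(j * k)).val := by
  simp only [dft_apply, complexIndicator, smul_eq_mul, mul_ite, mul_one, mul_zero,
    Finset.sum_ite_mem, Finset.univ_inter]
  refine Finset.sum_congr rfl fun j _ => ?_
  rw [← pow_mul, mul_comm a, pow_mul, ← stdAddChar_eq_pow_val, ← AddChar.map_nsmul_eq_pow,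
    nsmul_eq_mul]
  congr 1
  ring

lemma dft_complexIndicator_eq_sum_pow (S : Finset (ZMod n)) (k : ZMod n) :
    𝓕 (complexIndicator S) k = ∑ j ∈ S, (stdAddChar (1 : ZMod n) : ℂ) ^ (-(j * k)).val := by
  simpa using dft_complexIndicator_natCast_mul S 1 k

/-- An integral Fourier coefficient is invariant under multiplying the frequency by a unit. -/
lemma dft_complexIndicator_unit_mul_of_eq_intCast {S : Finset (ZMod n)} {k : ZMod n} {m : ℤ}
    (hm : 𝓕 (complexIndicator S) k = m) (u : (ZMod n)ˣ) :
    𝓕 (complexIndicator S) (u * k) = m := by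
  have hζ := isPrimitiveRoot_stdAddChar_one (n := n)
  set ζ : ℂ := stdAddChar (1 : ZMod n) with hζ_def
  let P : ℤ[X] := ∑ j ∈ S, X ^ (-(j * k)).val - C m
  have hP : aeval ζ P = 0 := by
    rw [dft_complexIndicator_eq_sum_pow, ← hζ_def] at hm
    simp [P, hm]
  have hdvd : minpoly ℤ ζ ∣ P :=
    minpoly.isIntegrallyClosed_dvd (hζ.isIntegral (NeZero.pos n)) hP
  rw [hζ.minpoly_eq_pow_coprime (val_coe_unit_coprime u)] at hdvd
  have hP' : aeval (ζ ^ (u : ZMod n).val) P = 0 :=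
    aeval_eq_zero_of_dvd_aeval_eq_zero hdvd (minpoly.aeval ℤ _)
  have h := dft_complexIndicator_natCast_mul S (u : ZMod n).val k
  rw [natCast_zmod_val, ← hζ_def] at h
  rw [h]
  simpa [P, sub_eq_zero] using hP'

/-- A Fourier coefficient which is invariant under multiplying the frequency by units is an
integer. -/
lemma exists_intCast_eq_dft_complexIndicator {S : Finset (ZMod n)} {k : ZMod n}
    (h : ∀ u : (ZMod n)ˣ, 𝓕 (complexIndicator S) (u * k) = 𝓕 (complexIndicator S) k) :
    ∃ m : ℤ, 𝓕 (complexIndicator S) k = m := by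
  have hζ := isPrimitiveRoot_stdAddChar_one (n := n)
  set ζ : ℂ := stdAddChar (1 : ZMod n) with hζ_def
  let L := IntermediateField.adjoin ℚ {ζ}
  have : IsCyclotomicExtension {n} ℚ L := by
    change IsCyclotomicExtension {n} ℚ (IntermediateField.adjoin ℚ {ζ}).toSubalgebra
    rw [IntermediateField.adjoin_simple_toSubalgebra_of_isAlgebraic
      (hζ.isIntegral (NeZero.pos n)).tower_top.isAlgebraic]
    exact hζ.adjoin_isCyclotomicExtension ℚ
  have : IsGalois ℚ L := IsCyclotomicExtension.isGalois {n} ℚ L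
  have : FiniteDimensional ℚ L := IsCyclotomicExtension.finiteDimensional {n} ℚ L
  let ξ : L := ⟨ζ, IntermediateField.mem_adjoin_simple_self ℚ ζ⟩
  have hξ : IsPrimitiveRoot ξ n :=
    IsPrimitiveRoot.of_map_of_injective (f := algebraMap L ℂ) hζ (algebraMap L ℂ).injective
  let z : L := ∑ j ∈ S, ξ ^ (-(j * k)).val
  have hz : algebraMap L ℂ z = 𝓕 (complexIndicator S) k := by
    rw [dft_complexIndicator_eq_sum_pow, ← hζ_def]
    simp only [z, map_sum, map_pow]
    rfl
  have hfixed : ∀ σ : L ≃ₐ[ℚ] L, σ z = z := by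
    intro σ
    obtain ⟨a, -, ha, hσ⟩ := hξ.isPrimitiveRoot_iff.mp (hξ.map_of_injective σ.injective)
    apply (algebraMap L ℂ).injective
    rw [hz, ← h (unitOfCoprime a ha), coe_unitOfCoprime, dft_complexIndicator_natCast_mul,
      ← hζ_def]
    simp only [z, map_sum, map_pow, ← hσ]
    rfl
  obtain ⟨q, hq⟩ := IntermediateField.mem_bot.mp ((IsGalois.mem_bot_iff_fixed z).mpr hfixed)
  have hint : IsIntegral ℤ z :=
    IsIntegral.sum _ fun j _ => (hξ.isIntegral (NeZero.pos n)).pow _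
  rw [← hq, isIntegral_algebraMap_iff (algebraMap ℚ L).injective,
    IsIntegrallyClosed.isIntegral_iff] at hint
  obtain ⟨m, hm⟩ := hint
  refine ⟨m, ?_⟩
  rw [← hz, ← hq, ← hm]
  simp

/-- Convolving with the indicator function of `S` multiplies Fourier coefficients. -/
lemma dft_mulVec_circulant (S : Finset (ZMod n)) (v : ZMod n → ℂ) (k : ZMod n) :
    𝓕 ((Matrix.of fun g h : ZMod n => if h - g ∈ S then (1 : ℂ) else 0).mulVec v) k =
      𝓕 (complexIndicator S) (-k) * 𝓕 v k := by
  simp only [dft_apply, Matrix.mulVec, dotProduct, Matrix.of_apply, smul_eq_mul, Finset.mul_sum]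
  rw [Finset.sum_comm]
  refine Finset.sum_congr rfl fun h _ => ?_
  rw [Finset.sum_mul, ← Equiv.sum_comp (Equiv.subLeft h)]
  refine Finset.sum_congr rfl fun j _ => ?_
  have hadd : (stdAddChar (-((h - j) * k)) : ℂ) =
      stdAddChar (-(j * -k)) * stdAddChar (-(h * k)) := by
    rw [← AddChar.map_add_eq_mul]
    congr 1
    ring
  simp only [Equiv.subLeft_apply, sub_sub_cancel, hadd, complexIndicator]
  ring

/-- The eigenvalues of a circulant 0-1 matrix are the Fourier coefficients of its symbol. -/
lemma mem_spectrum_circulant_iff (S : Finset (ZMod n)) (μ : ℂ) :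
    μ ∈ spectrum ℂ (Matrix.of fun g h : ZMod n => if h - g ∈ S then (1 : ℂ) else 0) ↔
      ∃ k, μ = 𝓕 (complexIndicator S) k := by
  rw [← Matrix.spectrum_toLin', ← Module.End.hasEigenvalue_iff_mem_spectrum]
  constructor
  · intro hμ
    obtain ⟨v, hv⟩ := hμ.exists_hasEigenvector
    have hne : 𝓕 v ≠ 0 := by simpa using hv.2
    obtain ⟨k, hk⟩ := Function.ne_iff.mp hne
    refine ⟨-k, mul_right_cancel₀ hk ?_⟩
    rw [← dft_mulVec_circulant, ← Matrix.toLin'_apply, hv.apply_eq_smul, _root_.map_smul]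
    rfl
  · rintro ⟨k, rfl⟩
    refine Module.End.hasEigenvalue_of_hasEigenvector (x := 𝓕⁻ (Pi.single (-k) 1)) ⟨?_, by simp⟩
    rw [Module.End.mem_eigenspace_iff, Matrix.toLin'_apply]
    apply (𝓕 : (ZMod n → ℂ) ≃ₗ[ℂ] (ZMod n → ℂ)).injective
    ext j
    rw [dft_mulVec_circulant, _root_.map_smul]
    simp only [LinearEquiv.apply_symm_apply, Pi.smul_apply, smul_eq_mul]
    obtain rfl | hj := eq_or_ne j (-k)
    · simp
    · simp [hj]

lemma ZMod.gcd_val_unit_mul {n : ℕ} (u : (ZMod n)ˣ) (x : ZMod n) :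
    Nat.gcd (u * x).val n = Nat.gcd x.val n := by
  rw [val_mul, ← Nat.gcd_rec, Nat.gcd_comm,
    (val_coe_unit_coprime u).gcd_mul_left_cancel]

lemma ZMod.exists_unit_mul_eq_of_gcd_val_eq {n : ℕ} {x y : ZMod n}
    (h : Nat.gcd x.val n = Nat.gcd y.val n) : ∃ u : (ZMod n)ˣ, u * x = y := by
  have key : ∀ z : ZMod n, ∃ u : (ZMod n)ˣ, z = u * (Nat.gcd z.val n : ℕ) := by
    intro z
    obtain ⟨d, hd, _, ⟨u, rfl⟩, rfl⟩ := z.eq_unit_mul_divisor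
    refine ⟨u, ?_⟩
    rw [gcd_val_unit_mul, val_natCast, ← Nat.gcd_rec, Nat.gcd_comm, Nat.gcd_eq_left hd]
  obtain ⟨u, hu⟩ := key x
  obtain ⟨w, hw⟩ := key y
  refine ⟨w * u⁻¹, ?_⟩
  rw [hw, ← h]
  nth_rw 1 [hu]
  simp [mul_assoc]

/-- Integrality of the Fourier coefficients of `S` means that units preserve `S`. -/
lemma forall_dft_complexIndicator_intCast_iff (S : Finset (ZMod n)) :
    (∀ k, ∃ m : ℤ, 𝓕 (complexIndicator S) k = m) ↔
      ∀ (u : (ZMod n)ˣ) (x : ZMod n), x ∈ S → u * x ∈ S := by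
  constructor
  · intro h u x hx
    have hfix : (fun j => complexIndicator S (u * j)) = complexIndicator S := by
      apply (𝓕 : (ZMod n → ℂ) ≃ₗ[ℂ] (ZMod n → ℂ)).injective
      ext k
      rw [dft_comp_unitMul]
      obtain ⟨m, hm⟩ := h k
      rw [hm, dft_complexIndicator_unit_mul_of_eq_intCast hm]
    simpa [complexIndicator, hx] using congrFun hfix x
  · refine fun h k => exists_intCast_eq_dft_complexIndicator fun u => ?_
    have hfix : (fun j => complexIndicator S ((u⁻¹ : (ZMod n)ˣ) * j)) = complexIndicator S := by
      ext j
      have : ((u⁻¹ : (ZMod n)ˣ) : ZMod n) * j ∈ S ↔ j ∈ S :=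
        ⟨fun hj => by simpa using h u _ hj, h u⁻¹ j⟩
      simp [complexIndicator, this]
    have := dft_comp_unitMul (complexIndicator S) u⁻¹ k
    rwa [hfix, inv_inv, eq_comm] at this

end

/-- **So's Theorem 7.1 (integral circulant graphs).** For `n > 1` and a symmetric subset
`S ⊆ ℤ/nℤ` with `0 ∉ S`, the circulant graph `D(ℤ/nℤ, S)` is integral if and only if
`S` is a union of the sets `G_n(d) = { k : 0 < k < n, gcd(k,n) = d }`; equivalently,
whenever two nonzero elements `x, y` satisfy `gcd(x, n) = gcd(y, n)` (gcd of canonical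
representatives with `n`), `x ∈ S` implies `y ∈ S`. -/
theorem integral_circulant_iff_gcd_closed
    (n : ℕ) [NeZero n] (hn : 1 < n)
    (S : Finset (ZMod n)) (hsym : ∀ s ∈ S, -s ∈ S) (h0 : (0 : ZMod n) ∉ S) :
    (∀ μ ∈ spectrum ℂ
        (Matrix.of fun g h : ZMod n => if h - g ∈ S then (1 : ℂ) else 0),
        ∃ m : ℤ, μ = (m : ℂ)) ↔
      (∀ x y : ZMod n, x ≠ 0 → y ≠ 0 → Nat.gcd x.val n = Nat.gcd y.val n →
        x ∈ S → y ∈ S) := by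
  simp only [mem_spectrum_circulant_iff, forall_exists_index, forall_eq_apply_imp_iff,
    forall_dft_complexIndicator_intCast_iff]
  constructor
  · intro h x y _ _ hxy hx
    obtain ⟨u, rfl⟩ := ZMod.exists_unit_mul_eq_of_gcd_val_eq hxy
    exact h u x hx
  · intro h u x hx
    have hx0 : x ≠ 0 := fun hx0 => h0 (hx0 ▸ hx)
    exact h x _ hx0 (by simpa using hx0) (ZMod.gcd_val_unit_mul u x).symm hx
end
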